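/- For every n ≥ 2, Q_{n+2} ≤ (2^{n+1} + 3)(2^n + 1) w_n³ and c_{n+2} > Q_{n+2}^{4/3}, where Q_{n+2} = w_{n+1}(2^n w_n + y_n). -/

import Mathlib

namespace Paper

/-- `s i = 2^{ν₂(i+1)}`, the largest power of 2 dividing `i+1`. -/
def s (i : ℕ) : ℕ := 2 ^ padicValNat 2 (i + 1)

/-- Continuant numerators, shifted by 2: `p 0 = p_{-2} = 0`, `p 1 = p_{-1} = 1`,
and `p (n+2) = p_n = s_n p_{n-1} + p_{n-2}`. -/
def p : ℕ → ℤ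
  | 0 => 0
  | 1 => 1
  | n + 2 => (s n : ℤ) * p (n + 1) + p n

/-- Continuant denominators, shifted by 2: `q 0 = q_{-2} = 1`, `q 1 = q_{-1} = 0`,
and `q (n+2) = q_n = s_n q_{n-1} + q_{n-2}`. -/
def q : ℕ → ℤ
  | 0 => 1
  | 1 => 0
  | n + 2 => (s n : ℤ) * q (n + 1) + q n

/-- Hurwitz–Kolden–Frame matrix of a finite sequence. -/
def M (l : List ℤ) : Matrix (Fin 2) (Fin 2) ℤ :=
  (l.map fun a => !![a, 1; 1, 0]).prod

/-- `u n = (s_1, s_2, ..., s_{2^n - 3})`. -/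
def u (n : ℕ) : List ℤ := (List.range (2 ^ n - 3)).map fun i => (s (i + 1) : ℤ)

/-- `v n = (s_1, s_2, ..., s_{2^n - 2})`. -/
def v (n : ℕ) : List ℤ := (List.range (2 ^ n - 2)).map fun i => (s (i + 1) : ℤ)

def c (n : ℕ) : ℤ := M (u n) 0 0
def e (n : ℕ) : ℤ := M (u n) 0 1
def d (n : ℕ) : ℤ := M (u n) 1 0
def f (n : ℕ) : ℤ := M (u n) 1 1
def w (n : ℕ) : ℤ := M (v n) 0 0
def y (n : ℕ) : ℤ := M (v n) 0 1
def x (n : ℕ) : ℤ := M (v n) 1 0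
def z (n : ℕ) : ℤ := M (v n) 1 1
def g (n : ℕ) : ℤ := c n + 2 * e n + f n
def r (n : ℕ) : ℤ := 2 ^ n * (w n + x n) + w n + y n + z n

end Paper

open Paper Filter Real

namespace Paper

theorem s_two_pow_sub_one (n : ℕ) : s (2 ^ n - 1) = 2 ^ n := by
  simp [s, Nat.sub_add_cancel Nat.one_le_two_pow]

theorem s_eq_one_of_even {i : ℕ} (hi : Even i) : s i = 1 := by
  have h : ¬ 2 ∣ i + 1 := by
    obtain ⟨k, rfl⟩ := hi
    omega
  simp [s, padicValNat.eq_zero_of_not_dvd h]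

theorem s_two_pow_add {n i : ℕ} (hi : i + 1 < 2 ^ n) : s (2 ^ n + i) = s i := by
  have hlt : padicValNat 2 (i + 1) < n :=
    (Nat.pow_lt_pow_iff_right one_lt_two).1
      ((Nat.le_of_dvd i.succ_pos pow_padicValNat_dvd).trans_lt hi)
  have h : padicValNat 2 (2 ^ n + i + 1) = padicValNat 2 (i + 1) := by
    have key (k : ℕ) (hk : k ≤ n) : 2 ^ k ∣ 2 ^ n + i + 1 ↔ 2 ^ k ∣ i + 1 := by
      rw [add_assoc]
      exact Nat.dvd_add_right (pow_dvd_pow 2 hk)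
    apply le_antisymm
    · by_contra! hgt
      have := (key _ hlt).1 ((padicValNat_dvd_iff_le (by omega)).2 hgt)
      exact pow_succ_padicValNat_not_dvd (by omega) this
    · exact (padicValNat_dvd_iff_le (by omega)).1 ((key _ hlt.le).2 pow_padicValNat_dvd)
  simp [s, h]

theorem v_succ {n : ℕ} (hn : 2 ≤ n) : v (n + 1) = v n ++ [(2 : ℤ) ^ n, 1] ++ v n := by
  have h4 : 2 ^ 2 ≤ 2 ^ n := Nat.pow_le_pow_right two_pos hn
  have hlen : 2 ^ (n + 1) - 2 = 2 ^ n - 2 + 2 + (2 ^ n - 2) := by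
    rw [pow_succ]
    omega
  have hpow : s (2 ^ n - 2 + 1) = 2 ^ n := by
    rw [show 2 ^ n - 2 + 1 = 2 ^ n - 1 by omega, s_two_pow_sub_one]
  have hone : s (2 ^ n - 2 + 1 + 1) = 1 := by
    rw [show 2 ^ n - 2 + 1 + 1 = 2 ^ n by omega]
    exact s_eq_one_of_even (even_two.pow_of_ne_zero (by omega))
  unfold v
  rw [hlen, List.range_add, List.range_add, List.map_append, List.map_append]
  congr 1
  · simp [List.range_succ, hpow, hone]
  · rw [List.map_map]
    refine List.map_congr_left fun i hi => ?_
    have hi := List.mem_range.1 hi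
    simp only [Function.comp_apply]
    rw [show 2 ^ n - 2 + 2 + i + 1 = 2 ^ n + (i + 1) by omega, s_two_pow_add (by omega)]

theorem v_eq_u_append {n : ℕ} (hn : 2 ≤ n) : v n = u n ++ [1] := by
  have h4 : 2 ^ 2 ≤ 2 ^ n := Nat.pow_le_pow_right two_pos hn
  have hone : s (2 ^ n - 3 + 1) = 1 := by
    apply s_eq_one_of_even
    rw [show 2 ^ n - 3 + 1 = 2 ^ n - 2 by omega]
    exact (Nat.even_sub (by omega)).2 (by simp [show n ≠ 0 by omega, Nat.even_pow])
  unfold v u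
  rw [show 2 ^ n - 2 = 2 ^ n - 3 + 1 by omega, List.range_succ, List.map_append]
  simp [hone]

theorem M_append (l₁ l₂ : List ℤ) : M (l₁ ++ l₂) = M l₁ * M l₂ := by
  simp [M]

theorem c_eq_y {n : ℕ} (hn : 2 ≤ n) : c n = y n := by
  simp [c, y, v_eq_u_append hn, M, Matrix.mul_apply, Fin.sum_univ_two]

theorem M_v_succ {n : ℕ} (hn : 2 ≤ n) :
    M (v (n + 1)) = M (v n) * !![2 ^ n + 1, 2 ^ n; 1, 1] * M (v n) := by
  rw [v_succ hn, M_append, M_append]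
  simp [M]

theorem w_succ {n : ℕ} (hn : 2 ≤ n) :
    w (n + 1) = w n * ((2 ^ n + 1) * w n + 2 ^ n * x n) + y n * (w n + x n) := by
  simp only [w, x, y, M_v_succ hn, Matrix.mul_apply, Fin.sum_univ_two]
  simp
  ring

theorem y_succ {n : ℕ} (hn : 2 ≤ n) :
    y (n + 1) = w n * ((2 ^ n + 1) * y n + 2 ^ n * z n) + y n * (y n + z n) := by
  simp only [w, z, y, M_v_succ hn, Matrix.mul_apply, Fin.sum_univ_two]
  simp
  ring

theorem x_succ {n : ℕ} (hn : 2 ≤ n) :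
    x (n + 1) = x n * ((2 ^ n + 1) * w n + 2 ^ n * x n) + z n * (w n + x n) := by
  simp only [w, x, z, M_v_succ hn, Matrix.mul_apply, Fin.sum_univ_two]
  simp
  ring

theorem z_succ {n : ℕ} (hn : 2 ≤ n) :
    z (n + 1) = x n * ((2 ^ n + 1) * y n + 2 ^ n * z n) + z n * (y n + z n) := by
  simp only [x, y, z, M_v_succ hn, Matrix.mul_apply, Fin.sum_univ_two]
  simp
  ring

theorem v_two : v 2 = [2, 1] := by
  have h2 : s 1 = 2 := s_two_pow_sub_one 1
  have h1 : s 2 = 1 := s_eq_one_of_even even_two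
  simp [v, List.range_succ, h1, h2]

/-- Comparisons between the entries of `M (v n)`; together they are preserved by the doubling
recurrence. -/
theorem entry_bounds {n : ℕ} (hn : 2 ≤ n) :
    0 < z n ∧ z n ≤ x n ∧ z n ≤ y n ∧ x n ≤ w n ∧ y n ≤ w n ∧
      w n ≤ 2 * y n ∧ x n ≤ 2 * z n := by
  induction n, hn using Nat.le_induction with
  | base => simp [w, x, y, z, v_two, M]
  | succ n hn ih =>
    obtain ⟨hz, hzx, hzy, hxw, hyw, hwy, hxz⟩ := ih
    have hx : 0 < x n := hz.trans_le hzx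
    have hy : 0 < y n := hz.trans_le hzy
    have hw : 0 < w n := hx.trans_le hxw
    rw [w_succ hn, x_succ hn, y_succ hn, z_succ hn]
    have hN : (0 : ℤ) < 2 ^ n := by positivity
    generalize (2 : ℤ) ^ n = N at *
    refine ⟨by positivity, by gcongr, by gcongr, by gcongr, by gcongr, ?_, ?_⟩
    · calc w n * ((N + 1) * w n + N * x n) + y n * (w n + x n)
          ≤ w n * ((N + 1) * (2 * y n) + N * (2 * z n)) + y n * (2 * y n + 2 * z n) := by gcongr
        _ = 2 * (w n * ((N + 1) * y n + N * z n) + y n * (y n + z n)) := by ring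
    · calc x n * ((N + 1) * w n + N * x n) + z n * (w n + x n)
          ≤ x n * ((N + 1) * (2 * y n) + N * (2 * z n)) + z n * (2 * y n + 2 * z n) := by gcongr
        _ = 2 * (x n * ((N + 1) * y n + N * z n) + z n * (y n + z n)) := by ring

end Paper

/-- For n ≥ 2, with `Q_{n+2} = w_{n+1}(2^n w_n + y_n)`:
`Q_{n+2} ≤ (2^{n+1} + 3)(2^n + 1) w_n³` and `c_{n+2} > Q_{n+2}^{4/3}`. -/
theorem Q_bounds (n : ℕ) (hn : 2 ≤ n) :
    w (n + 1) * (2 ^ n * w n + y n) ≤ (2 ^ (n + 1) + 3) * (2 ^ n + 1) * w n ^ 3 ∧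
    ((w (n + 1) * (2 ^ n * w n + y n) : ℤ) : ℝ) ^ ((4 : ℝ) / 3) < (c (n + 2) : ℝ) := by
  obtain ⟨hz, hzx, hzy, hxw, hyw, -, -⟩ := entry_bounds hn
  obtain ⟨hz', -, hzy', -, hyw', hwy', -⟩ := entry_bounds (n := n + 1) (by omega)
  have hx : 0 < x n := hz.trans_le hzx
  have hy : 0 < y n := hz.trans_le hzy
  have hw : 0 < w n := hx.trans_le hxw
  have hy' : 0 < y (n + 1) := hz'.trans_le hzy'
  have hw' : 0 < w (n + 1) := hy'.trans_le hyw'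
  have hN : (4 : ℤ) ≤ 2 ^ n := by
    calc (4 : ℤ) = 2 ^ 2 := by norm_num
      _ ≤ 2 ^ n := pow_le_pow_right₀ one_le_two hn
  have hys : y (n + 2) = _ := y_succ (n := n + 1) (by omega)
  have hws := w_succ hn
  rw [c_eq_y (by omega : 2 ≤ n + 2)]
  simp only [pow_succ (2 : ℤ) n] at hys ⊢
  generalize (2 : ℤ) ^ n = N at *
  have hlin : N * w n + y n ≤ (N + 1) * w n := by linarith
  have hup : w (n + 1) ≤ (2 * N + 3) * w n ^ 2 := by
    have h₁ : w n * x n ≤ w n * w n := by gcongr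
    have h₂ : y n * (w n + x n) ≤ w n * (w n + w n) := by gcongr
    have h₃ : N * (w n * x n) ≤ N * (w n * w n) := by gcongr
    linarith
  have hlow : (N + 1) * w n ^ 2 ≤ w (n + 1) := by
    have : 0 ≤ w n * (N * x n) + y n * (w n + x n) := by positivity
    linarith
  have hylow : N * w (n + 1) ^ 2 ≤ y (n + 2) := by
    have h₁ : w (n + 1) * (N * w (n + 1)) ≤ w (n + 1) * (N * (2 * y (n + 1))) := by gcongr
    have : 0 ≤ w (n + 1) * (y (n + 1) + 2 * N * z (n + 1)) +
        y (n + 1) * (y (n + 1) + z (n + 1)) := by positivity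
    linarith
  have hypos : 0 < y (n + 2) := lt_of_lt_of_le (by positivity) hylow
  refine ⟨?_, ?_⟩
  · calc w (n + 1) * (N * w n + y n)
        ≤ ((2 * N + 3) * w n ^ 2) * ((N + 1) * w n) := by gcongr
      _ = (N * 2 + 3) * (N + 1) * w n ^ 3 := by ring
  have hcube : (N + 1) ^ 2 < N ^ 3 := by nlinarith
  have hint : (w (n + 1) * (N * w n + y n)) ^ 4 < y (n + 2) ^ 3 :=
    calc (w (n + 1) * (N * w n + y n)) ^ 4
        ≤ (w (n + 1) * ((N + 1) * w n)) ^ 4 := by gcongr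
      _ = w (n + 1) ^ 4 * ((N + 1) * w n ^ 2) ^ 2 * (N + 1) ^ 2 := by ring
      _ ≤ w (n + 1) ^ 4 * w (n + 1) ^ 2 * (N + 1) ^ 2 := by gcongr
      _ < w (n + 1) ^ 4 * w (n + 1) ^ 2 * N ^ 3 := by gcongr
      _ = (N * w (n + 1) ^ 2) ^ 3 := by ring
      _ ≤ y (n + 2) ^ 3 := by gcongr
  have hQ : 0 < w (n + 1) * (N * w n + y n) := by positivity
  generalize w (n + 1) * (N * w n + y n) = Q at *
  have hQ' : (0 : ℝ) ≤ Q := by exact_mod_cast hQ.le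
  refine lt_of_pow_lt_pow_left₀ 3 (by exact_mod_cast hypos.le) ?_
  rw [← Real.rpow_natCast, ← Real.rpow_mul hQ',
    show (4 : ℝ) / 3 * (3 : ℕ) = (4 : ℕ) by norm_num, Real.rpow_natCast]
  exact_mod_cast hint
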